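/- arXiv:1112.1629 — 3 statements merged into one kernel-verified Lean document; each statement's English description precedes it below -/
import Mathlib

section
/- For k ≥ 2, every subset of a set of the form {n ∈ [a, a+N] : n is k-free} is itself realized: if S ⊆ ℤ is finite and there exists t with S + t consisting entirely of k-free integers, then for any finite Q disjoint from S there exists t' with S + t' all k-free and (Q + t') containing no k-free integer. -/
/-- An integer `n` is `k`-free if `q^k ∤ n` for every prime `q`. -/
def KFree (k : ℕ) (n : ℤ) : Prop := ∀ q : ℕ, q.Prime → ¬ ((q : ℤ)^k ∣ n)

lemma sieve_count (c L X d : ℕ) (hd : 0 < d) (h : Nat.Coprime d L) :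
    ((Finset.range X).filter (fun m => d ^ 2 ∣ c + m * L)).card ≤ X / d ^ 2 + 1 := by
  rw [← Finset.card_range (X / d ^ 2 + 1)]
  have hd2 : 0 < d ^ 2 := by positivity
  apply Finset.card_le_card_of_injOn (fun m => m / d ^ 2)
  · intro m hm
    simp only [Finset.coe_filter, Finset.mem_range, Set.mem_ofPred_eq] at hm
    simp only [Finset.coe_range, Set.mem_Iio]
    exact Nat.lt_succ_of_le (Nat.div_le_div_right hm.1.le)
  · intro a ha b hb hab
    simp only [Finset.coe_filter, Finset.mem_range, Set.mem_ofPred_eq] at ha hb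
    have h1 : c + a * L ≡ c + b * L [MOD d ^ 2] :=
      ((Nat.modEq_zero_iff_dvd).2 ha.2).trans ((Nat.modEq_zero_iff_dvd).2 hb.2).symm
    have h2 : a * L ≡ b * L [MOD d ^ 2] := Nat.ModEq.add_left_cancel' c h1
    have h3 : a ≡ b [MOD d ^ 2] :=
      Nat.ModEq.cancel_right_of_coprime (Nat.Coprime.pow_left 2 h) h2
    have h4 : a % d ^ 2 = b % d ^ 2 := h3
    have hab' : a / d ^ 2 = b / d ^ 2 := hab
    rw [← Nat.div_add_mod a (d ^ 2), ← Nat.div_add_mod b (d ^ 2), h4, hab']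

lemma sieve (I : Finset ℕ) (hI : ∀ c ∈ I, 0 < c) (L : ℕ) (hL : 0 < L) :
    ∃ m : ℕ, ∀ c ∈ I, ∀ d : ℕ, 2 * I.card + 1 < d → Nat.Coprime d L → ¬ d ^ 2 ∣ c + m * L := by
  classical
  set M := 2 * I.card + 1 with hM
  set C := I.sum id + 1 with hC
  have hCle : ∀ c ∈ I, c ≤ C := fun c hc =>
    (Finset.single_le_sum (f := id) (fun _ _ => Nat.zero_le _) hc).trans (Nat.le_succ _)
  set B := 2 * C * L with hB
  have hC1 : 1 ≤ C := by omega
  have hB1 : 1 ≤ B := by rw [hB]; exact Nat.one_le_iff_ne_zero.2 (by positivity)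
  have hM1 : 1 ≤ M := by omega
  set X := 4 * B * M ^ 2 with hX
  have hX1 : 1 ≤ X := by rw [hX]; exact Nat.one_le_iff_ne_zero.2 (by positivity)
  set D := 2 * B * M with hD
  by_contra! hcon
  have hsub : Finset.range X ⊆ I.biUnion (fun c => ((Finset.Ioc M (M ⊔ D)).filter (fun d => Nat.Coprime d L)).biUnion
      (fun d => (Finset.range X).filter (fun m => d ^ 2 ∣ c + m * L))) := by
    intro m hm
    obtain ⟨c, hc, d, hMd, hcop, hdvd⟩ := hcon m
    simp only [Finset.mem_biUnion, Finset.mem_filter, Finset.mem_Ioc]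
    refine ⟨c, hc, d, ⟨⟨hMd, le_trans ?_ (le_max_right _ _)⟩, hcop⟩, hm, hdvd⟩
    have h1 := Nat.le_of_dvd (by have := hI c hc; omega) hdvd
    have h2 : c + m * L ≤ D ^ 2 := by
      have e : D ^ 2 = C * L * X + C * L * X := by rw [hD, hX, hB]; ring
      have h3 : m * L ≤ C * L * X := by
        have := (Finset.mem_range.1 hm).le
        calc m * L ≤ X * L := Nat.mul_le_mul_right _ this
          _ ≤ C * (X * L) := Nat.le_mul_of_pos_left _ hC1
          _ = _ := by ring
      have h4 : c ≤ C * L * X := by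
        calc c ≤ C := hCle c hc
          _ ≤ C * (L * X) := Nat.le_mul_of_pos_right _ (Nat.mul_pos hL hX1)
          _ = _ := by ring
      omega
    exact (Nat.pow_le_pow_iff_left (by norm_num)).1 (h1.trans h2)
  have hMD : M ≤ D := by rw [hD]; exact Nat.le_mul_of_pos_left _ (by omega)
  rw [max_eq_right hMD] at hsub
  have hcard := Finset.card_le_card hsub
  rw [Finset.card_range] at hcard
  have hin : ∀ c ∈ I, (((Finset.Ioc M D).filter (fun d => Nat.Coprime d L)).biUnion
      (fun d => (Finset.range X).filter (fun m => d ^ 2 ∣ c + m * L))).card ≤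
      ∑ d ∈ Finset.Ioc M D, (X / d ^ 2 + 1) := by
    intro c hc
    refine Finset.card_biUnion_le.trans ?_
    refine le_trans (Finset.sum_le_sum (g := fun d => X / d ^ 2 + 1) ?_) ?_
    · intro d hd
      simp only [Finset.mem_filter, Finset.mem_Ioc] at hd
      exact sieve_count c L X d (by omega) hd.2
    · exact Finset.sum_le_sum_of_subset (Finset.filter_subset _ _)
  have h5 : X ≤ I.card * ∑ d ∈ Finset.Ioc M D, (X / d ^ 2 + 1) := by
    refine hcard.trans (Finset.card_biUnion_le.trans ((Finset.sum_le_sum hin).trans ?_))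
    simp
  have h6 : ((∑ d ∈ Finset.Ioc M D, (X / d ^ 2 + 1) : ℕ) : ℝ) ≤ X / M + D := by
    push_cast
    rw [Finset.sum_add_distrib]
    apply add_le_add
    · calc ∑ d ∈ Finset.Ioc M D, ((X / d ^ 2 : ℕ) : ℝ)
          ≤ ∑ d ∈ Finset.Ioc M D, (X : ℝ) * ((d : ℝ) ^ 2)⁻¹ := by
            apply Finset.sum_le_sum
            intro d _
            have := @Nat.cast_div_le ℝ _ _ _ X (d ^ 2)
            rw [← div_eq_mul_inv]
            exact_mod_cast this
        _ = (X : ℝ) * ∑ d ∈ Finset.Ioc M D, ((d : ℝ) ^ 2)⁻¹ := by rw [Finset.mul_sum]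
        _ ≤ (X : ℝ) * ((M : ℝ)⁻¹ - (D : ℝ)⁻¹) := by
            gcongr
            exact sum_Ioc_inv_sq_le_sub (by omega) hMD
        _ ≤ X / M := by
            rw [div_eq_mul_inv]
            gcongr
            have : (0 : ℝ) ≤ (D : ℝ)⁻¹ := by positivity
            linarith
    · simp
  have h7 : (X : ℝ) / M = 4 * B * M := by
    have : (M : ℝ) ≠ 0 := by positivity
    rw [hX]; push_cast; field_simp
  have h8 : (X : ℝ) ≤ I.card * (6 * B * M) := by
    have : (X : ℝ) ≤ I.card * ((∑ d ∈ Finset.Ioc M D, (X / d ^ 2 + 1) : ℕ) : ℝ) := by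
      exact_mod_cast h5
    refine this.trans ?_
    gcongr
    refine h6.trans ?_
    rw [h7, hD]; push_cast
    linarith
  have h9 : X ≤ I.card * (6 * B * M) := by exact_mod_cast h8
  have h10 : I.card * (6 * B * M) < X := by
    have : X = (4 * M) * (B * M) := by rw [hX]; ring
    rw [this]
    have e : I.card * (6 * B * M) = (6 * I.card) * (B * M) := by ring
    rw [e]
    exact Nat.mul_lt_mul_of_pos_right (by omega) (Nat.mul_pos hB1 hM1)
  omega

lemma crt_step (k : ℕ) (hk : 2 ≤ k) (S : Finset ℤ) (t : ℤ)
    (ht : ∀ s ∈ S, KFree k (s + t)) (M : ℕ) (Q : Finset ℤ) (hQ : Disjoint S Q) :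
    ∃ (r : ℤ) (L : ℕ), 0 < L ∧ M.factorial ∣ L ∧
      (∀ p : ℕ, p.Prime → p ∣ L → p ^ k ∣ L ∧ ∀ s ∈ S, ¬ ((p : ℤ) ^ k ∣ s + r)) ∧
      (∀ q ∈ Q, ∃ p : ℕ, p.Prime ∧ p ^ k ∣ L ∧ (p : ℤ) ^ k ∣ q + r) := by
  classical
  induction Q using Finset.induction_on with
  | empty =>
    refine ⟨t, M.factorial ^ k, by positivity, dvd_pow_self _ (by omega), ?_, by simp⟩
    intro p hp hpd
    exact ⟨pow_dvd_pow_of_dvd (hp.dvd_of_dvd_pow hpd) k, fun s hs => ht s hs p hp⟩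
  | insert q Q hq ih =>
    rw [Finset.disjoint_insert_right] at hQ
    obtain ⟨r, L, hL, hML, hS, hQ'⟩ := ih hQ.2
    obtain ⟨p, hple, hp⟩ := Nat.exists_infinite_primes (L + 1 + ∑ s ∈ S, (s - q).natAbs)
    have hpL : Nat.Coprime L (p ^ k) := by
      refine Nat.Coprime.pow_right k (Nat.Coprime.symm ((Nat.Prime.coprime_iff_not_dvd hp).2 ?_))
      intro h
      have := Nat.le_of_dvd hL h
      omega
    have hco : IsCoprime (L : ℤ) ((p ^ k : ℕ) : ℤ) := Nat.isCoprime_iff_coprime.2 hpL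
    obtain ⟨a, b, hab⟩ := hco
    have hr1 : ∃ r' : ℤ, (L : ℤ) ∣ r' - r ∧ ((p ^ k : ℕ) : ℤ) ∣ r' + q := by
      refine ⟨r * (b * ((p ^ k : ℕ) : ℤ)) - q * (a * L), ⟨-(r + q) * a, ?_⟩, ⟨(r + q) * b, ?_⟩⟩
      · linear_combination r * hab
      · linear_combination -q * hab
    obtain ⟨r', h1, h2⟩ := hr1
    have key : ∀ (x : ℤ) (p' : ℕ), p' ^ k ∣ L → ((p' : ℤ) ^ k ∣ x + r' ↔ (p' : ℤ) ^ k ∣ x + r) := by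
      intro x p' hp'
      have h3 : (p' : ℤ) ^ k ∣ r' - r := dvd_trans (by exact_mod_cast hp') h1
      have e : x + r' = (r' - r) + (x + r) := by ring
      rw [e]
      exact dvd_add_right h3
    refine ⟨r', L * p ^ k, Nat.mul_pos hL (pow_pos hp.pos k), Dvd.dvd.mul_right hML _, ?_, ?_⟩
    · intro p' hp' hd
      rcases (Nat.Prime.dvd_mul hp').1 hd with hd | hd
      · obtain ⟨u, v⟩ := hS p' hp' hd
        refine ⟨Dvd.dvd.mul_right u _, fun s hs => ?_⟩
        rw [key s p' u]
        exact v s hs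
      · have hpp : p' = p := (Nat.prime_dvd_prime_iff_eq hp' hp).1 (hp'.dvd_of_dvd_pow hd)
        subst hpp
        refine ⟨Dvd.intro_left _ rfl, fun s hs h => ?_⟩
        have h3 : ((p' ^ k : ℕ) : ℤ) ∣ s - q := by
          have : ((p' ^ k : ℕ) : ℤ) ∣ s + r' := by push_cast; exact h
          have h4 := dvd_sub this h2
          have e : s + r' - (r' + q) = s - q := by ring
          rwa [e] at h4
        have hne : s - q ≠ 0 := by
          intro h0
          have : s = q := by omega
          exact hQ.1 (this ▸ hs)
        have h5 := Nat.le_of_dvd (Int.natAbs_pos.2 hne) (Int.natCast_dvd.1 h3)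
        have h6 : (s - q).natAbs ≤ ∑ s ∈ S, (s - q).natAbs :=
          Finset.single_le_sum (f := fun s => (s - q).natAbs) (fun _ _ => Nat.zero_le _) hs
        have h7 : p' ≤ p' ^ k := Nat.le_self_pow (by omega) p'
        omega
    · intro x hx
      rcases Finset.mem_insert.1 hx with rfl | hx
      · refine ⟨p, hp, Dvd.intro_left _ rfl, ?_⟩
        rw [add_comm]; exact_mod_cast h2
      · obtain ⟨p', hp', u, v⟩ := hQ' x hx
        exact ⟨p', hp', Dvd.dvd.mul_right u _, (key x p' u).2 v⟩

/-- Every subset of a patch of the `k`-free integers is itself a patch: if some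
translate of `S` consists entirely of `k`-free integers, then for any finite `Q`
disjoint from `S` there is a translate making all of `S` `k`-free and no element
of `Q` `k`-free. -/
theorem subpatch_realized (k : ℕ) (hk : 2 ≤ k) (S : Finset ℤ)
    (hS : ∃ t : ℤ, ∀ s ∈ S, KFree k (s + t))
    (Q : Finset ℤ) (hQ : Disjoint S Q) :
    ∃ t' : ℤ, (∀ s ∈ S, KFree k (s + t')) ∧ (∀ q ∈ Q, ¬ KFree k (q + t')) := by
  classical
  obtain ⟨t, ht⟩ := hS
  obtain ⟨r, L, hL, hML, hS, hQ'⟩ := crt_step k hk S t ht (2 * S.card + 1) Q hQ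
  have key : ∀ (x m : ℤ) (p' : ℕ), p' ^ k ∣ L →
      ((p' : ℤ) ^ k ∣ x + (r + m * L) ↔ (p' : ℤ) ^ k ∣ x + r) := by
    intro x m p' hp'
    have h3 : (p' : ℤ) ^ k ∣ m * L := Dvd.dvd.mul_left (by exact_mod_cast hp') m
    have e : x + (r + m * L) = m * L + (x + r) := by ring
    rw [e]
    exact dvd_add_right h3
  set A : ℕ := 1 + ∑ s ∈ S, (s + r).natAbs with hA
  have hpos : ∀ s ∈ S, 0 < s + r + A * L := by
    intro s hs
    have h6 : (s + r).natAbs ≤ ∑ s ∈ S, (s + r).natAbs :=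
      Finset.single_le_sum (f := fun s => (s + r).natAbs) (fun _ _ => Nat.zero_le _) hs
    have h7 : A ≤ A * L := Nat.le_mul_of_pos_right _ hL
    have h8 : (A : ℤ) ≤ A * L := by exact_mod_cast h7
    omega
  set I : Finset ℕ := S.image (fun s => (s + r + A * L).toNat) with hI
  have hIc : I.card ≤ S.card := Finset.card_image_le
  obtain ⟨m, hm⟩ := sieve I (by
    intro c hc
    obtain ⟨s, hs, rfl⟩ := Finset.mem_image.1 hc
    have := hpos s hs
    omega) L hL
  refine ⟨r + ((A + m : ℕ) : ℤ) * L, ?_, ?_⟩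
  · intro s hs p hp hdvd
    by_cases hpL : p ∣ L
    · obtain ⟨u, v⟩ := hS p hp hpL
      exact v s hs ((key s _ p u).1 hdvd)
    · have hpM : 2 * S.card + 1 < p := by
        by_contra! hle
        exact hpL ((Nat.dvd_factorial hp.pos hle).trans hML)
      refine hm _ (Finset.mem_image_of_mem _ hs) p (by omega)
        ((Nat.Prime.coprime_iff_not_dvd hp).2 hpL) ?_
      have h1 : (p : ℤ) ^ 2 ∣ s + (r + ((A + m : ℕ) : ℤ) * L) := (pow_dvd_pow _ hk).trans hdvd
      have h2 := Int.toNat_of_nonneg (hpos s hs).le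
      zify
      rw [h2]
      convert h1 using 1
      push_cast; ring
  · intro q hq hfree
    obtain ⟨p, hp, u, v⟩ := hQ' q hq
    exact hfree p hp ((key q _ p u).2 v)
end

section
/- Let k ≥ 2 and let P = {p₁,...,p_r} be a finite set of distinct integers. Then the density δ(P) := lim_{R→∞} (1/(2R)) · #{t ∈ [−R,R] : p_i + t is k-free for all i} exists and equals ∏_{p prime} (1 − c_p/p^k), where c_p = #{residues of P modulo p^k}. -/
open Filter

open Classical in
lemma kf_multiples_card (X d : ℕ) (hd : 0 < d) :
    ((Finset.Icc (-(X : ℤ)) X).filter (fun n => n ≠ 0 ∧ (d : ℤ) ∣ n)).card ≤ 2 * (X / d) := by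
  have hsub : (Finset.Icc (-(X : ℤ)) X).filter (fun n => n ≠ 0 ∧ (d : ℤ) ∣ n) ⊆
      ((Finset.Icc (-((X / d : ℕ) : ℤ)) ((X / d : ℕ) : ℤ)).erase 0).image (fun j => (d : ℤ) * j) := by
    intro n hn
    simp only [Finset.mem_filter, Finset.mem_Icc] at hn
    obtain ⟨⟨h1, h2⟩, h0, j, rfl⟩ := hn
    refine Finset.mem_image.2 ⟨j, ?_, rfl⟩
    have hd' : (0 : ℤ) < d := by exact_mod_cast hd
    simp only [Finset.mem_erase, Finset.mem_Icc]
    refine ⟨fun h => h0 (by simp [h]), ?_, ?_⟩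
    · push_cast
      have : -j ≤ (X : ℤ) / d := (Int.le_ediv_iff_mul_le hd').2 (by linarith)
      linarith
    · push_cast
      exact (Int.le_ediv_iff_mul_le hd').2 (by linarith)
  refine (Finset.card_le_card hsub).trans (Finset.card_image_le.trans ?_)
  rw [Finset.card_erase_of_mem (Finset.mem_Icc.2
    ⟨neg_nonpos.2 (Int.natCast_nonneg _), Int.natCast_nonneg _⟩), Int.card_Icc]
  omega

open Classical in
lemma kf_class_card (R m : ℕ) [NeZero m] (v : ZMod m) :
    |((((Finset.Icc (-(R : ℤ)) R).filter (fun t : ℤ => (t : ZMod m) = v)).card : ℝ)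
      - (2 * R + 1) / m)| ≤ 1 := by
  have hm : 0 < m := Nat.pos_of_ne_zero (NeZero.ne m)
  have hm' : (0 : ℤ) < m := by exact_mod_cast hm
  have h := Int.Ioc_filter_modEq_card (-(R : ℤ) - 1) R (r := m) hm' (v.val : ℤ)
  have heq : (Finset.Icc (-(R : ℤ)) R).filter (fun t : ℤ => (t : ZMod m) = v) =
      (Finset.Ioc (-(R : ℤ) - 1) R).filter (fun t => t ≡ (v.val : ℤ) [ZMOD m]) := by
    ext t
    simp only [Finset.mem_filter, Finset.mem_Icc, Finset.mem_Ioc]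
    rw [← ZMod.intCast_eq_intCast_iff]
    have hv : (((v.val : ℕ) : ℤ) : ZMod m) = v := by
      rw [Int.cast_natCast, ZMod.natCast_zmod_val]
    rw [hv]
    refine and_congr_left fun _ => ?_
    omega
  rw [heq]
  set C := ((Finset.Ioc (-(R : ℤ) - 1) R).filter (fun t => t ≡ (v.val : ℤ) [ZMOD m])).card
  have hmR : (0 : ℝ) < m := by exact_mod_cast hm
  set x : ℚ := (((R : ℤ) : ℚ) - ((v.val : ℤ) : ℚ)) / ((m : ℤ) : ℚ) with hx
  set y : ℚ := (((-(R : ℤ) - 1 : ℤ) : ℚ) - ((v.val : ℤ) : ℚ)) / ((m : ℤ) : ℚ) with hy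
  have hmQ : (0 : ℚ) < m := by exact_mod_cast hm
  have hxy : x - y = (2 * R + 1) / m := by
    rw [hx, hy]; push_cast; field_simp; ring
  have hle : y ≤ x := by
    have : (0 : ℚ) ≤ (2 * R + 1) / m := by positivity
    linarith
  rw [max_eq_left (by have := Int.floor_le_floor hle; omega)] at h
  have hQ : |((C : ℚ) - (2 * R + 1) / m)| ≤ 1 := by
    have hC : (C : ℚ) = (⌊x⌋ : ℚ) - ⌊y⌋ := by exact_mod_cast h
    rw [hC, ← hxy, abs_le]
    have := Int.floor_le x
    have := Int.floor_le y
    have := Int.lt_floor_add_one x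
    have := Int.lt_floor_add_one y
    constructor <;> linarith
  have hR : ((|((C : ℚ) - (2 * R + 1) / m)| : ℚ) : ℝ) ≤ ((1 : ℚ) : ℝ) := Rat.cast_le.2 hQ
  push_cast at hR
  exact hR

lemma kf_tendsto_lin (a b : ℝ) :
    Tendsto (fun R : ℕ => (b * R + a) / (2 * R : ℝ)) atTop (nhds (b / 2)) := by
  have h1 : Tendsto (fun R : ℕ => b / 2 + (a / 2) / (R : ℝ)) atTop (nhds (b / 2 + 0)) :=
    tendsto_const_nhds.add (tendsto_const_div_atTop_nhds_zero_nat _)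
  rw [add_zero] at h1
  refine h1.congr' ?_
  filter_upwards [eventually_gt_atTop 0] with R hR
  have : (R : ℝ) ≠ 0 := by positivity
  field_simp

open Classical in
lemma kf_periodic (m : ℕ) [NeZero m] (G : Finset (ZMod m)) :
    Tendsto (fun R : ℕ => (((Finset.Icc (-(R : ℤ)) R).filter
      (fun t : ℤ => (t : ZMod m) ∈ G)).card : ℝ) / (2 * R)) atTop (nhds ((G.card : ℝ) / m)) := by
  have key : ∀ R : ℕ, |(((Finset.Icc (-(R : ℤ)) R).filter
      (fun t : ℤ => (t : ZMod m) ∈ G)).card : ℝ) - G.card * ((2 * R + 1) / m)| ≤ G.card := by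
    intro R
    have h := Finset.card_eq_sum_card_fiberwise (s := (Finset.Icc (-(R : ℤ)) R).filter
      (fun t : ℤ => (t : ZMod m) ∈ G)) (t := G) (f := fun t : ℤ => (t : ZMod m))
      (fun t ht => (Finset.mem_filter.1 ht).2)
    rw [h]
    push_cast
    rw [← nsmul_eq_mul, ← Finset.sum_const, ← Finset.sum_sub_distrib]
    refine (Finset.abs_sum_le_sum_abs _ _).trans ?_
    refine (Finset.sum_le_card_nsmul _ _ 1 ?_).trans (by simp)
    intro v hv
    suffices hset : ((Finset.Icc (-(R : ℤ)) R).filter (fun t : ℤ => (t : ZMod m) ∈ G)).filter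
        (fun t : ℤ => (t : ZMod m) = v) =
        (Finset.Icc (-(R : ℤ)) R).filter (fun t : ℤ => (t : ZMod m) = v) by
      rw [hset]
      exact kf_class_card R m v
    ext t
    simp only [Finset.mem_filter]
    constructor
    · rintro ⟨⟨a, _⟩, b⟩; exact ⟨a, b⟩
    · rintro ⟨a, b⟩; exact ⟨⟨a, b ▸ hv⟩, b⟩
  have hl := kf_tendsto_lin (G.card / m - G.card) (2 * G.card / m)
  have hu := kf_tendsto_lin (G.card / m + G.card) (2 * G.card / m)
  have e : (2 * G.card / m : ℝ) / 2 = G.card / m := by ring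
  rw [e] at hl hu
  refine tendsto_of_tendsto_of_tendsto_of_le_of_le hl hu ?_ ?_
  · intro R
    have := (abs_le.1 (key R)).1
    refine div_le_div_of_nonneg_right ?_ (by positivity)
    have e : (G.card : ℝ) * ((2 * R + 1) / m) = 2 * G.card / m * R + G.card / m := by ring
    linarith
  · intro R
    have := (abs_le.1 (key R)).2
    refine div_le_div_of_nonneg_right ?_ (by positivity)
    have e : (G.card : ℝ) * ((2 * R + 1) / m) = 2 * G.card / m * R + G.card / m := by ring
    linarith

open Classical in
lemma kf_sieve (k : ℕ) (P : Finset ℤ) (s : Finset Nat.Primes) :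
    Tendsto (fun R : ℕ => (((Finset.Icc (-(R : ℤ)) R).filter
      (fun t : ℤ => ∀ q ∈ s, ∀ p ∈ P, ¬ (((q : ℕ) : ℤ) ^ k ∣ p + t))).card : ℝ) / (2 * R)) atTop
      (nhds (∏ q ∈ s, (1 - ((P.image (fun x : ℤ => (x : ZMod ((q : ℕ)^k)))).card : ℝ) /
          ((q : ℕ) : ℝ)^k))) := by
  let a : s → ℕ := fun q => ((q : Nat.Primes) : ℕ) ^ k
  have : ∀ i, NeZero (a i) := fun i => ⟨pow_ne_zero _ i.1.2.ne_zero⟩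
  have : NeZero (∏ i, a i) := ⟨Finset.prod_ne_zero_iff.2 fun i _ => NeZero.ne (a i)⟩
  have hcop : Pairwise (fun i j => Nat.Coprime (a i) (a j)) := by
    intro i j hij
    refine Nat.Coprime.pow _ _ ((Nat.coprime_primes i.1.2 j.1.2).2 ?_)
    intro h
    exact hij (Subtype.ext (Subtype.ext h))
  let e := ZMod.prodEquivPi a hcop
  let C : ∀ i, Finset (ZMod (a i)) := fun i => P.image (fun x : ℤ => (x : ZMod (a i)))
  let B : ∀ i, Finset (ZMod (a i)) := fun i => ((C i).image (fun x => -x))ᶜ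
  let G : Finset (ZMod (∏ i, a i)) := (Fintype.piFinset B).map e.symm.toEquiv.toEmbedding
  have hmem : ∀ t : ℤ, ((t : ZMod (∏ i, a i)) ∈ G) ↔
      ∀ q ∈ s, ∀ p ∈ P, ¬ (((q : ℕ) : ℤ) ^ k ∣ p + t) := by
    intro t
    have h1 : ((t : ZMod (∏ i, a i)) ∈ G) ↔ ∀ i, (t : ZMod (a i)) ∈ B i := by
      have : e (t : ZMod (∏ i, a i)) = fun i => (t : ZMod (a i)) := by
        rw [map_intCast]; rfl
      simp only [G, Finset.mem_map_equiv, Fintype.mem_piFinset]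
      have h2 : e.symm.toEquiv.symm (t : ZMod (∏ i, a i)) = fun i => (t : ZMod (a i)) := this
      rw [h2]
    rw [h1]
    simp only [B, C, Finset.mem_compl, Finset.mem_image, not_exists, not_and, Subtype.forall]
    refine forall₂_congr fun q hq => ?_
    constructor
    · intro h p hp hd
      refine h _ ⟨p, hp, rfl⟩ ?_
      have h3 : ((p + t : ℤ) : ZMod (a ⟨q, hq⟩)) = 0 :=
        (ZMod.intCast_zmod_eq_zero_iff_dvd _ _).2 (by simpa [a] using hd)
      push_cast at h3
      linear_combination -h3
    · rintro h _ ⟨p, hp, rfl⟩ hh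
      refine h p hp ?_
      have h3 : ((p + t : ℤ) : ZMod (a ⟨q, hq⟩)) = 0 := by
        push_cast
        linear_combination -hh
      simpa [a] using (ZMod.intCast_zmod_eq_zero_iff_dvd _ _).1 h3
  have hval : (G.card : ℝ) / ((∏ i, a i : ℕ) : ℝ) =
      ∏ q ∈ s, (1 - ((P.image (fun x : ℤ => (x : ZMod ((q : ℕ)^k)))).card : ℝ) /
          ((q : ℕ) : ℝ)^k) := by
    rw [← Finset.prod_coe_sort s]
    simp only [G, Finset.card_map, Fintype.card_piFinset]
    push_cast
    rw [← Finset.prod_div_distrib]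
    refine Finset.prod_congr rfl fun i _ => ?_
    have hc : (B i).card = a i - (C i).card := by
      simp only [B]
      rw [Finset.card_compl, Finset.card_image_of_injective _ neg_injective, ZMod.card]
    have hle : (C i).card ≤ a i := by
      have := Finset.card_le_univ (C i)
      rwa [ZMod.card] at this
    have ha : (a i : ℝ) = ((i : Nat.Primes) : ℝ) ^ k := by simp [a]
    have ha0 : (a i : ℝ) ≠ 0 := by exact_mod_cast NeZero.ne (a i)
    rw [hc, Nat.cast_sub hle, sub_div, div_self ha0, ha]
  rw [← hval]
  refine (kf_periodic _ G).congr fun R => ?_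
  simp only [hmem]

lemma kf_summable (k : ℕ) (hk : 2 ≤ k) :
    Summable (fun q : Nat.Primes => 1 / ((q : ℕ) : ℝ) ^ k) :=
  (Real.summable_one_div_nat_pow.2 hk).comp_injective (i := fun q : Nat.Primes => (q : ℕ))
    Subtype.coe_injective

open Classical in
lemma kf_bad_one (k : ℕ) (hk : 2 ≤ k) (s : Finset Nat.Primes) (p : ℤ) (R : ℕ) :
    (((Finset.Icc (-(R : ℤ)) R).filter
      (fun t : ℤ => ∃ q : Nat.Primes, q ∉ s ∧ ((q : ℕ) : ℤ) ^ k ∣ p + t)).card : ℝ) ≤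
    1 + 2 * (R + p.natAbs) * ∑' q : {q // q ∉ s}, 1 / (((q : Nat.Primes) : ℕ) : ℝ) ^ k := by
  set X := R + p.natAbs with hX
  let F : Finset {q : Nat.Primes // q ∉ s} :=
    Set.Finite.toFinset (s := {q | ((q : Nat.Primes) : ℕ) ≤ X})
      ((Set.finite_Iic X).preimage (f := fun q : {q : Nat.Primes // q ∉ s} => ((q : Nat.Primes) : ℕ))
        (Function.Injective.injOn fun a b h => Subtype.ext (Subtype.ext h)))
  let M : {q : Nat.Primes // q ∉ s} → Finset ℤ := fun q =>
    (Finset.Icc (-(X : ℤ)) X).filter (fun n => n ≠ 0 ∧ ((((q : Nat.Primes) : ℕ) ^ k : ℕ) : ℤ) ∣ n)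
  have hsub : ((Finset.Icc (-(R : ℤ)) R).filter
      (fun t : ℤ => ∃ q : Nat.Primes, q ∉ s ∧ ((q : ℕ) : ℤ) ^ k ∣ p + t)).image (fun t => p + t) ⊆
      {0} ∪ F.biUnion M := by
    intro n hn
    obtain ⟨t, ht, rfl⟩ := Finset.mem_image.1 hn
    simp only [Finset.mem_filter, Finset.mem_Icc] at ht
    obtain ⟨⟨h1, h2⟩, q, hq, hd⟩ := ht
    by_cases h0 : p + t = 0
    · simp [h0]
    refine Finset.mem_union_right _ (Finset.mem_biUnion.2 ⟨⟨q, hq⟩, ?_, ?_⟩)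
    · refine (Set.Finite.mem_toFinset _).2 ?_
      change (q : ℕ) ≤ X
      have h3 : (q : ℕ) ^ k ≤ (p + t).natAbs :=
        Nat.le_of_dvd (Int.natAbs_pos.2 h0) (Int.natCast_dvd.1 (by exact_mod_cast hd))
      have h4 : (q : ℕ) ≤ (q : ℕ) ^ k := Nat.le_self_pow (by omega) _
      omega
    · simp only [M, Finset.mem_filter, Finset.mem_Icc]
      refine ⟨by omega, h0, by exact_mod_cast hd⟩
  have hc := Finset.card_le_card hsub
  rw [Finset.card_image_of_injective _ (add_right_injective p)] at hc
  have hc2 := hc.trans ((Finset.card_union_le _ _).trans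
    (Nat.add_le_add_left Finset.card_biUnion_le _))
  rw [Finset.card_singleton] at hc2
  have hM : ∀ q ∈ F, ((M q).card : ℝ) ≤ 2 * X * (1 / (((q : Nat.Primes) : ℕ) : ℝ) ^ k) := by
    intro q _
    have h := kf_multiples_card X (((q : Nat.Primes) : ℕ) ^ k) (pow_pos q.1.2.pos k)
    have h' : ((M q).card : ℝ) ≤ 2 * ((X / ((q : Nat.Primes) : ℕ) ^ k : ℕ) : ℝ) := by
      exact_mod_cast h
    have h2 := Nat.cast_div_le (α := ℝ) (m := X) (n := ((q : Nat.Primes) : ℕ) ^ k)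
    push_cast at h2
    rw [mul_assoc, mul_one_div]
    linarith
  have hsum := (kf_summable k hk).subtype {q | q ∉ s}
  calc _ ≤ ((1 + ∑ q ∈ F, (M q).card : ℕ) : ℝ) := by exact_mod_cast hc2
    _ = 1 + ∑ q ∈ F, ((M q).card : ℝ) := by push_cast; rfl
    _ ≤ 1 + ∑ q ∈ F, 2 * X * (1 / (((q : Nat.Primes) : ℕ) : ℝ) ^ k) := by
        gcongr with q hq; exact hM q hq
    _ = 1 + 2 * X * ∑ q ∈ F, (1 / (((q : Nat.Primes) : ℕ) : ℝ) ^ k) := by rw [Finset.mul_sum]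
    _ ≤ 1 + 2 * X * ∑' q : {q // q ∉ s}, 1 / (((q : Nat.Primes) : ℕ) : ℝ) ^ k := by
        gcongr
        exact hsum.sum_le_tsum F (fun i _ => by positivity)
    _ = _ := by rw [hX]; push_cast; rfl

lemma kf_multipliable (k : ℕ) (hk : 2 ≤ k) (P : Finset ℤ) :
    Multipliable (fun p : Nat.Primes =>
        (1 - ((P.image (fun x : ℤ => (x : ZMod ((p : ℕ)^k)))).card : ℝ) /
          ((p : ℕ) : ℝ)^k)) := by
  simp only [sub_eq_add_neg]
  refine Real.multipliable_one_add_of_summable ?_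
  refine Summable.neg ?_
  refine Summable.of_nonneg_of_le (fun _ => by positivity) ?_
    ((kf_summable k hk).mul_left (P.card : ℝ))
  intro q
  rw [mul_one_div]
  gcongr
  exact Finset.card_image_le

/-- Patch frequencies of the `k`-free integers: for a finite set `P` of
integers, the density of `t` with `p + t` `k`-free for all `p ∈ P` exists and
equals `∏_p (1 - c_p/p^k)`, where `c_p` is the number of distinct residues of
`P` modulo `p^k`. -/
theorem kfree_patch_density (k : ℕ) (hk : 2 ≤ k) (P : Finset ℤ) :
    Tendsto (fun R : ℕ =>
      (Nat.card {t : ℤ // t ∈ Finset.Icc (-(R : ℤ)) (R : ℤ) ∧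
          ∀ p ∈ P, KFree k (p + t)} : ℝ) / (2 * R)) atTop
      (nhds (∏' p : Nat.Primes,
        (1 - ((P.image (fun x : ℤ => (x : ZMod ((p : ℕ)^k)))).card : ℝ) /
          ((p : ℕ) : ℝ)^k))) := by
  classical
  set c : Nat.Primes → ℝ := fun p =>
        (1 - ((P.image (fun x : ℤ => (x : ZMod ((p : ℕ)^k)))).card : ℝ) /
          ((p : ℕ) : ℝ)^k) with hcdef
  have hprod : Tendsto (fun s : Finset Nat.Primes => ∏ q ∈ s, c q) atTop (nhds (∏' q, c q)) :=
    (kf_multipliable k hk P).hasProd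
  let T : Finset Nat.Primes → ℝ := fun s =>
    ∑' q : {q // q ∉ s}, 1 / (((q : Nat.Primes) : ℕ) : ℝ) ^ k
  have hT : Tendsto T atTop (nhds 0) :=
    tendsto_tsum_compl_atTop_zero (fun q : Nat.Primes => 1 / ((q : ℕ) : ℝ) ^ k)
  let A : ℕ → Finset ℤ := fun R => (Finset.Icc (-(R : ℤ)) R).filter
    (fun t => ∀ p ∈ P, KFree k (p + t))
  let S : Finset Nat.Primes → ℕ → Finset ℤ := fun s R => (Finset.Icc (-(R : ℤ)) R).filter
      (fun t : ℤ => ∀ q ∈ s, ∀ p ∈ P, ¬ (((q : ℕ) : ℤ) ^ k ∣ p + t))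
  have hA : ∀ R : ℕ, Nat.card {t : ℤ // t ∈ Finset.Icc (-(R : ℤ)) (R : ℤ) ∧
          ∀ p ∈ P, KFree k (p + t)} = (A R).card := by
    intro R
    refine Nat.subtype_card (A R) fun t => ?_
    simp only [A, Finset.mem_filter]
  simp only [hA]
  have hS : ∀ s, Tendsto (fun R : ℕ => ((S s R).card : ℝ) / (2 * R)) atTop
      (nhds (∏ q ∈ s, c q)) := fun s => kf_sieve k P s
  have hAS : ∀ s R, (A R).card ≤ (S s R).card := by
    intro s R
    refine Finset.card_le_card fun t ht => ?_
    simp only [A, S, Finset.mem_filter] at ht ⊢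
    exact ⟨ht.1, fun q _ p hp => ht.2 p hp q q.2⟩
  let b : Finset Nat.Primes → ℝ := fun s => ∑ p ∈ P, (1 + 2 * (p.natAbs : ℝ) * T s)
  have hSA : ∀ s R, ((S s R).card : ℝ) ≤ (A R).card + (2 * P.card * T s * R + b s) := by
    intro s R
    let Bd : ℤ → Finset ℤ := fun p => (Finset.Icc (-(R : ℤ)) R).filter
      (fun t : ℤ => ∃ q : Nat.Primes, q ∉ s ∧ ((q : ℕ) : ℤ) ^ k ∣ p + t)
    have hsub : S s R ⊆ A R ∪ P.biUnion Bd := by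
      intro t ht
      simp only [S, Finset.mem_filter] at ht
      by_cases h : ∀ p ∈ P, KFree k (p + t)
      · exact Finset.mem_union_left _ (Finset.mem_filter.2 ⟨ht.1, h⟩)
      · refine Finset.mem_union_right _ ?_
        simp only [KFree, not_forall, not_not] at h
        obtain ⟨p, hp, q, hq, hd⟩ := h
        refine Finset.mem_biUnion.2 ⟨p, hp, Finset.mem_filter.2 ⟨ht.1, ⟨q, hq⟩, ?_, hd⟩⟩
        intro hqs
        exact ht.2 ⟨q, hq⟩ hqs p hp hd
    have h1 := (Finset.card_le_card hsub).trans ((Finset.card_union_le _ _).trans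
      (Nat.add_le_add_left Finset.card_biUnion_le _))
    have h2 : ((S s R).card : ℝ) ≤ (A R).card + ∑ p ∈ P, ((Bd p).card : ℝ) := by exact_mod_cast h1
    have h3 : ∑ p ∈ P, ((Bd p).card : ℝ) ≤ ∑ p ∈ P, (1 + 2 * (R + p.natAbs) * T s) :=
      Finset.sum_le_sum fun p _ => kf_bad_one k hk s p R
    have h4 : ∑ p ∈ P, (1 + 2 * ((R : ℝ) + p.natAbs) * T s) = 2 * P.card * T s * R + b s := by
      have : ∀ p : ℤ, (1 + 2 * ((R : ℝ) + p.natAbs) * T s) =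
        2 * T s * R + (1 + 2 * (p.natAbs : ℝ) * T s) := fun p => by ring
      simp only [this, Finset.sum_add_distrib (f := fun _ => 2 * T s * (R : ℝ)), Finset.sum_const,
        nsmul_eq_mul, b]
      ring
    linarith
  have hlow : ∀ s, Tendsto (fun R : ℕ => ((S s R).card : ℝ) / (2 * R) -
      (2 * P.card * T s * R + b s) / (2 * R)) atTop (nhds (∏ q ∈ s, c q - P.card * T s)) := by
    intro s
    have h := kf_tendsto_lin (b s) (2 * P.card * T s)
    have e : (2 * P.card * T s) / 2 = P.card * T s := by ring
    rw [e] at h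
    exact (hS s).sub h
  have hlim : Tendsto (fun s => ∏ q ∈ s, c q - P.card * T s) atTop (nhds (∏' q, c q)) := by
    simpa using hprod.sub (hT.const_mul (P.card : ℝ))
  refine tendsto_order.2 ⟨fun x hx => ?_, fun x hx => ?_⟩
  · obtain ⟨s, hs⟩ := (hlim.eventually (lt_mem_nhds hx)).exists
    filter_upwards [(hlow s).eventually (lt_mem_nhds hs)] with R hR
    refine hR.trans_le ?_
    rw [← sub_div]
    refine div_le_div_of_nonneg_right ?_ (by positivity)
    linarith [hSA s R]
  · obtain ⟨s, hs⟩ := (hprod.eventually (gt_mem_nhds hx)).exists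
    filter_upwards [(hS s).eventually (gt_mem_nhds hs)] with R hR
    refine lt_of_le_of_lt ?_ hR
    refine div_le_div_of_nonneg_right ?_ (by positivity)
    exact_mod_cast hAS s R
end

section
/- For the squarefree integers (k = 2), density({t : t−1, t, t+1 squarefree}) = ∏_p (1 − 3/p^2) and density({t : t−1, t squarefree, t+1 not squarefree}) = ∏_p (1 − 2/p^2) − ∏_p (1 − 3/p^2), where the products run over all primes p. -/
open Filter

lemma sf_fiber (M : ℕ) (hM : 0 < M) (g : ZMod M) (R : ℕ) :
    |(((Finset.Icc (-(R:ℤ)) R).filter (fun t : ℤ => (t : ZMod M) = g)).card : ℝ)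
      - 2 * R / M| ≤ 2 := by
  have h1 : (Finset.Icc (-(R:ℤ)) R).filter (fun t : ℤ => (t : ZMod M) = g)
      = (Finset.Ioc (-(R:ℤ) - 1) R).filter (fun t : ℤ => t ≡ (g.cast : ℤ) [ZMOD (M:ℤ)]) := by
    ext t
    simp only [Finset.mem_filter, Finset.mem_Icc, Finset.mem_Ioc]
    rw [← ZMod.intCast_eq_intCast_iff, ZMod.intCast_zmod_cast]
    constructor <;> rintro ⟨⟨h, h'⟩, h''⟩ <;> exact ⟨⟨by omega, h'⟩, h''⟩
  rw [h1]
  have h2 := Int.Ioc_filter_modEq_card (-(R:ℤ) - 1) R (r := (M:ℤ)) (by exact_mod_cast hM) (g.cast : ℤ)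
  generalize hc : (Finset.card _) = c at h2 ⊢
  generalize (g.cast : ℤ) = v at h2
  have hMq : (1:ℚ) ≤ M := by exact_mod_cast hM
  set x : ℚ := (((R:ℤ):ℚ) - (v:ℚ)) / ((M:ℤ):ℚ) with hx
  set y : ℚ := (((-(R:ℤ) - 1 : ℤ):ℚ) - (v:ℚ)) / ((M:ℤ):ℚ) with hy
  have hxy : x - y = 2 * R / M + 1 / M := by
    rw [hx, hy]; push_cast; field_simp; ring
  have hM1 : (1:ℚ) / M ≤ 1 := by rw [div_le_one (by linarith)]; exact hMq
  have hM0 : (0:ℚ) ≤ 1 / M := by positivity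
  have hR0 : (0:ℚ) ≤ 2 * R / M := by positivity
  have hyx : y ≤ x := by linarith
  have hfl : ⌊y⌋ ≤ ⌊x⌋ := Int.floor_le_floor hyx
  rw [max_eq_left (by omega)] at h2
  have h3 : (c:ℚ) = ⌊x⌋ - ⌊y⌋ := by exact_mod_cast h2
  have a1 := Int.floor_le x
  have a2 := Int.lt_floor_add_one x
  have b1 := Int.floor_le y
  have b2 := Int.lt_floor_add_one y
  have h4 : |(c:ℚ) - 2 * R / M| ≤ 2 := by
    rw [abs_le]; constructor <;> linarith
  have h5 := (Rat.cast_le (K := ℝ)).2 h4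
  push_cast at h5
  exact h5

open Classical in
lemma sf_local (A : Finset ℤ) (hA : ∀ a ∈ A, |a| ≤ 1) (m : ℕ) (hm : 4 ≤ m)
    [NeZero m] :
    ((Finset.univ.filter (fun x : ZMod m => ∀ a ∈ A, x + (a : ZMod m) ≠ 0)).card : ℝ)
      = (m:ℝ) - A.card := by
  have h1 : Finset.univ.filter (fun x : ZMod m => ∀ a ∈ A, x + (a : ZMod m) ≠ 0)
      = (A.image (fun a : ℤ => -(a : ZMod m)))ᶜ := by
    ext x
    simp only [Finset.mem_filter, Finset.mem_univ, true_and, Finset.mem_compl, Finset.mem_image,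
      not_exists, not_and]
    refine forall₂_congr fun a _ => not_congr ?_
    rw [add_eq_zero_iff_eq_neg]
    exact eq_comm
  have h2 : (A.image (fun a : ℤ => -(a : ZMod m))).card = A.card := by
    apply Finset.card_image_of_injOn
    intro a ha b hb hab
    have hab' : (a : ZMod m) = b := neg_injective hab
    rw [ZMod.intCast_eq_intCast_iff, Int.modEq_iff_dvd] at hab'
    have ha1 := abs_le.1 (hA a ha)
    have hb1 := abs_le.1 (hA b hb)
    have hp4 : (4:ℤ) ≤ (m : ℤ) := by exact_mod_cast hm
    have := Int.eq_zero_of_abs_lt_dvd hab' (by rw [abs_lt]; constructor <;> linarith)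
    omega
  have h3 := Finset.card_add_card_compl (A.image (fun a : ℤ => -(a : ZMod m)))
  rw [ZMod.card, h2] at h3
  rw [h1, eq_sub_iff_add_eq]
  rw [← Nat.cast_add, add_comm, h3]

open Classical in
lemma sf_sieve (A : Finset ℤ) (hA : ∀ a ∈ A, |a| ≤ 1) (s : Finset Nat.Primes) :
    ∃ C : ℝ, ∀ R : ℕ,
      |(((Finset.Icc (-(R:ℤ)) R).filter
        (fun t : ℤ => ∀ p ∈ s, ∀ a ∈ A, ¬ (((p:ℕ)^2 : ℕ) : ℤ) ∣ t + a)).card : ℝ)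
        - 2 * R * ∏ p ∈ s, (1 - (A.card : ℝ) / ((p:ℕ):ℝ)^2)| ≤ C := by
  let m : s → ℕ := fun p => ((p : Nat.Primes) : ℕ)^2
  have hm : ∀ i, NeZero (m i) := fun i => ⟨pow_ne_zero 2 (i : Nat.Primes).2.ne_zero⟩
  have hcop : Pairwise (Function.onFun Nat.Coprime m) := by
    intro i j hij
    apply Nat.Coprime.pow
    rw [Nat.coprime_primes i.1.2 j.1.2]
    intro h
    exact hij (Subtype.ext (Subtype.ext h))
  have hMpos : 0 < ∏ i, m i := Finset.prod_pos fun i _ => Nat.pos_of_ne_zero (hm i).ne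
  set M := ∏ i, m i with hMdef
  have : NeZero M := ⟨hMpos.ne'⟩
  let e := ZMod.prodEquivPi m hcop
  let L : (i : s) → Finset (ZMod (m i)) := fun i =>
    Finset.univ.filter (fun x : ZMod (m i) => ∀ a ∈ A, x + (a : ZMod (m i)) ≠ 0)
  let G : Finset (ZMod M) := (Fintype.piFinset L).map e.symm.toEquiv.toEmbedding
  have hG : (G.card : ℝ) / M = ∏ p ∈ s, (1 - (A.card : ℝ) / ((p:ℕ):ℝ)^2) := by
    rw [Finset.card_map, Fintype.card_piFinset, hMdef]
    push_cast
    rw [← Finset.prod_div_distrib, ← Finset.prod_coe_sort s]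
    refine Finset.prod_congr rfl fun i _ => ?_
    have hfour : 4 ≤ m i := by
      have := (i : Nat.Primes).2.two_le
      change 4 ≤ ((i : Nat.Primes) : ℕ)^2
      nlinarith
    have hL : ((L i).card : ℝ) = (m i : ℝ) - A.card := sf_local A hA (m i) hfour
    have hne : (m i : ℝ) ≠ 0 := by exact_mod_cast (hm i).ne
    have hmi : (((i:Nat.Primes):ℕ):ℝ)^2 = (m i : ℝ) := by simp [m]
    rw [hL, hmi, sub_div, div_self hne]
  have hmem : ∀ t : ℤ, (∀ p ∈ s, ∀ a ∈ A, ¬ (((p:ℕ)^2 : ℕ) : ℤ) ∣ t + a) ↔ (t : ZMod M) ∈ G := by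
    intro t
    have : (t : ZMod M) ∈ G ↔ e (t : ZMod M) ∈ Fintype.piFinset L := by
      simp only [G, Finset.mem_map_equiv]
      rfl
    rw [this, Fintype.mem_piFinset]
    have h2 : ∀ i, e (t : ZMod M) i = (t : ZMod (m i)) := by
      intro i
      rw [map_intCast]; rfl
    simp only [h2, L, Finset.mem_filter, Finset.mem_univ, true_and]
    constructor
    · intro h i a ha h0
      refine h i i.2 a ha ?_
      rw [← ZMod.intCast_zmod_eq_zero_iff_dvd]
      push_cast
      exact h0
    · intro h p hp a ha h0
      refine h ⟨p, hp⟩ a ha ?_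
      rw [← ZMod.intCast_zmod_eq_zero_iff_dvd] at h0
      push_cast at h0
      exact h0
  refine ⟨2 * G.card, fun R => ?_⟩
  rw [← hG]
  simp only [hmem]
  rw [Finset.card_eq_sum_card_fiberwise (f := fun t : ℤ => (t : ZMod M)) (t := G)
    (s := (Finset.Icc (-(R:ℤ)) R).filter (fun t : ℤ => (t : ZMod M) ∈ G))
    (fun t ht => (Finset.mem_filter.1 ht).2)]
  have h5 : ∀ g ∈ G, (((Finset.Icc (-(R:ℤ)) R).filter (fun t : ℤ => (t : ZMod M) ∈ G)).filter
      (fun t : ℤ => (t : ZMod M) = g)) =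
      (Finset.Icc (-(R:ℤ)) R).filter (fun t : ℤ => (t : ZMod M) = g) := by
    intro g hg
    ext t
    simp only [Finset.mem_filter]
    constructor
    · rintro ⟨⟨h, _⟩, h'⟩; exact ⟨h, h'⟩
    · rintro ⟨h, h'⟩; exact ⟨⟨h, h' ▸ hg⟩, h'⟩
  rw [Finset.sum_congr rfl (fun g hg => by rw [h5 g hg])]
  have h6 : (2 * (R:ℝ) * ((G.card : ℝ) / M)) = ∑ g ∈ G, 2 * (R:ℝ) / M := by
    rw [Finset.sum_const, nsmul_eq_mul]; ring
  rw [h6]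
  push_cast
  rw [← Finset.sum_sub_distrib]
  refine (Finset.abs_sum_le_sum_abs _ _).trans ?_
  refine (Finset.sum_le_sum fun g _ => sf_fiber M hMpos g R).trans ?_
  rw [Finset.sum_const, nsmul_eq_mul]; linarith

lemma sf_bad (a : ℤ) (ha : |a| ≤ 1) (d : ℕ) (hd : 0 < d) (R : ℕ) :
    (((Finset.Icc (-(R:ℤ)) R).filter (fun t : ℤ => t + a ≠ 0 ∧ (d:ℤ) ∣ t + a)).card : ℝ)
      ≤ 2 * (R + 1) * (1 / d) := by
  have ha1 := abs_le.1 ha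
  have hd' : (0:ℤ) < d := by exact_mod_cast hd
  set K : ℕ := (R + 1) / d with hK
  have h1 : ((Finset.Icc (-(R:ℤ)) R).filter (fun t : ℤ => t + a ≠ 0 ∧ (d:ℤ) ∣ t + a)).card
      ≤ ((Finset.Icc (-(K:ℤ)) K).erase 0).card := by
    apply Finset.card_le_card_of_injOn (fun t => (t + a) / d)
    · intro t ht
      obtain ⟨h1, h0, k, hk⟩ := Finset.mem_filter.1 ht
      rw [Finset.mem_Icc] at h1
      have hdk : (t + a) / (d:ℤ) = k := by rw [hk, Int.mul_ediv_cancel_left _ hd'.ne']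
      have hk0 : k ≠ 0 := by rintro rfl; simp at hk; exact h0 hk
      simp only [hdk, Finset.coe_erase, Set.mem_sdiff, Finset.mem_coe, Finset.mem_Icc,
        Set.mem_singleton_iff]
      have hKc : (K:ℤ) = ((R:ℤ) + 1) / d := by rw [hK]; push_cast; rfl
      refine ⟨⟨?_, ?_⟩, hk0⟩
      · have : -k ≤ K := by
          rw [hKc, Int.le_ediv_iff_mul_le hd']; nlinarith
        linarith
      · rw [hKc, Int.le_ediv_iff_mul_le hd']; nlinarith
    · intro t ht t' ht' h
      obtain ⟨_, _, k, hk⟩ := Finset.mem_filter.1 ht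
      obtain ⟨_, _, k', hk'⟩ := Finset.mem_filter.1 ht'
      simp only [hk, hk', Int.mul_ediv_cancel_left _ hd'.ne'] at h
      subst h
      linarith
  rw [Finset.card_erase_of_mem (by simp), Int.card_Icc] at h1
  have h2 : ((Finset.Icc (-(R:ℤ)) R).filter (fun t : ℤ => t + a ≠ 0 ∧ (d:ℤ) ∣ t + a)).card
      ≤ 2 * K := by omega
  have h3 : (K:ℝ) ≤ ((R + 1 : ℕ) : ℝ) / d := by rw [hK]; exact Nat.cast_div_le
  have h4 : (((Finset.Icc (-(R:ℤ)) R).filter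
      (fun t : ℤ => t + a ≠ 0 ∧ (d:ℤ) ∣ t + a)).card : ℝ) ≤ 2 * K := by exact_mod_cast h2
  push_cast at h3
  calc _ ≤ _ := h4
    _ ≤ 2 * (((R:ℝ) + 1) / d) := by linarith
    _ = _ := by ring

lemma sf_squarefree_iff (n : ℤ) :
    Squarefree n ↔ ∀ p : Nat.Primes, ¬ (((p:ℕ)^2 : ℕ) : ℤ) ∣ n := by
  rw [← Int.squarefree_natAbs, Nat.squarefree_iff_prime_squarefree]
  constructor
  · intro h p hp
    apply h p p.2
    rw [← sq]
    exact Int.natCast_dvd.1 hp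
  · intro h p hp hd
    apply h ⟨p, hp⟩
    rw [Int.natCast_dvd]
    simpa [sq] using hd

open Classical in
lemma sf_density (A : Finset ℤ) (hA : ∀ a ∈ A, |a| ≤ 1) :
    Tendsto (fun R : ℕ =>
      (((Finset.Icc (-(R:ℤ)) R).filter (fun t : ℤ => ∀ a ∈ A, Squarefree (t + a))).card : ℝ)
        / (2 * R)) atTop (nhds (∏' p : Nat.Primes, (1 - (A.card : ℝ) / ((p : ℕ) : ℝ)^2))) := by
  have hsum : Summable (fun p : Nat.Primes => 1 / ((p:ℕ):ℝ)^2) := by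
    have := (Real.summable_one_div_nat_pow (p := 2)).2 (by norm_num)
    exact this.comp_injective Subtype.val_injective
  have hmul : Multipliable (fun p : Nat.Primes => 1 - (A.card : ℝ) / ((p : ℕ) : ℝ)^2) := by
    have := Real.multipliable_one_add_of_summable (hsum.mul_left (-(A.card : ℝ)))
    refine this.congr fun p => ?_
    ring
  have hprod := hmul.hasProd
  set P := ∏' p : Nat.Primes, (1 - (A.card : ℝ) / ((p : ℕ) : ℝ)^2) with hP
  rw [Metric.tendsto_atTop]
  intro ε hε
  set k : ℝ := (A.card : ℝ) with hk
  have hk0 : 0 ≤ k := by positivity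
  obtain ⟨s₀, hs₀⟩ := summable_iff_vanishing_norm.1 hsum (ε / (8 * (k + 1))) (by positivity)
  have hev := (Metric.tendsto_nhds.1 hprod (ε/4) (by positivity)).and (eventually_ge_atTop s₀)
  obtain ⟨s, hsP, hss⟩ := hev.exists
  rw [Real.dist_eq] at hsP
  obtain ⟨C, hC⟩ := sf_sieve A hA s
  -- the exceptional set
  have key : ∀ R : ℕ,
      (((Finset.Icc (-(R:ℤ)) R).filter
        (fun t : ℤ => ∀ p ∈ s, ∀ a ∈ A, ¬ (((p:ℕ)^2 : ℕ) : ℤ) ∣ t + a)).card : ℝ)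
      ≤ (((Finset.Icc (-(R:ℤ)) R).filter (fun t : ℤ => ∀ a ∈ A, Squarefree (t + a))).card : ℝ)
        + k * (1 + 2 * (R + 1) * (ε / (8 * (k + 1)))) := by
    intro R
    let u : Finset Nat.Primes := (Finset.subtype Nat.Prime (Finset.range (R + 2))) \ s
    let B : ℤ → Nat.Primes → Finset ℤ := fun a p =>
      (Finset.Icc (-(R:ℤ)) R).filter (fun t : ℤ => t + a ≠ 0 ∧ ((((p:ℕ)^2 : ℕ)):ℤ) ∣ t + a)
    have hsub : (Finset.Icc (-(R:ℤ)) R).filter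
        (fun t : ℤ => ∀ p ∈ s, ∀ a ∈ A, ¬ (((p:ℕ)^2 : ℕ) : ℤ) ∣ t + a) ⊆
        (Finset.Icc (-(R:ℤ)) R).filter (fun t : ℤ => ∀ a ∈ A, Squarefree (t + a)) ∪
        A.biUnion (fun a => {-a} ∪ u.biUnion (B a)) := by
      intro t ht
      obtain ⟨htI, hts⟩ := Finset.mem_filter.1 ht
      by_cases hsf : ∀ a ∈ A, Squarefree (t + a)
      · exact Finset.mem_union_left _ (Finset.mem_filter.2 ⟨htI, hsf⟩)
      · apply Finset.mem_union_right
        push Not at hsf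
        obtain ⟨a, ha, hsf⟩ := hsf
        rw [Finset.mem_biUnion]
        refine ⟨a, ha, ?_⟩
        by_cases h0 : t + a = 0
        · apply Finset.mem_union_left
          rw [Finset.mem_singleton]; omega
        · apply Finset.mem_union_right
          rw [sf_squarefree_iff] at hsf
          push Not at hsf
          obtain ⟨p, hp⟩ := hsf
          rw [Finset.mem_biUnion]
          refine ⟨p, ?_, Finset.mem_filter.2 ⟨htI, h0, hp⟩⟩
          refine Finset.mem_sdiff.2 ⟨?_, fun hps => hts p hps a ha hp⟩
          refine Finset.mem_subtype.2 (Finset.mem_range.2 ?_)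
          have h1 := Int.le_of_dvd (abs_pos.2 h0) ((dvd_abs _ _).2 hp)
          have h2 : |t + a| ≤ R + 1 := by
            have := abs_le.1 (hA a ha)
            rw [Finset.mem_Icc] at htI
            rw [abs_le]; constructor <;> linarith
          have h3 : (p:ℕ)^2 ≤ R + 1 := by exact_mod_cast h1.trans h2
          have h4 := p.2.two_le
          have h5 : (p:ℕ) ≤ (p:ℕ)^2 := Nat.le_self_pow (by norm_num) _
          change (p:ℕ) < R + 2
          omega
    have h1 := (Finset.card_le_card hsub).trans (Finset.card_union_le _ _)
    have h2 : ((A.biUnion (fun a => {-a} ∪ u.biUnion (B a))).card : ℝ)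
        ≤ k * (1 + 2 * (R + 1) * (ε / (8 * (k + 1)))) := by
      have h3 : ((A.biUnion (fun a => {-a} ∪ u.biUnion (B a))).card : ℝ)
          ≤ ∑ a ∈ A, (({-a} ∪ u.biUnion (B a)).card : ℝ) := by
        exact_mod_cast Finset.card_biUnion_le
      refine h3.trans ?_
      rw [hk, ← nsmul_eq_mul]
      refine Finset.sum_le_card_nsmul _ _ _ fun a ha => ?_
      have h4 : (({-a} ∪ u.biUnion (B a)).card : ℝ) ≤ 1 + ∑ p ∈ u, ((B a p).card : ℝ) := by
        have h5 := Finset.card_union_le {-a} (u.biUnion (B a))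
        rw [Finset.card_singleton] at h5
        exact_mod_cast h5.trans (Nat.add_le_add_left Finset.card_biUnion_le 1)
      refine h4.trans ?_
      have h6 : ∑ p ∈ u, ((B a p).card : ℝ) ≤ ∑ p ∈ u, 2 * ((R:ℝ) + 1) * (1 / ((p:ℕ):ℝ)^2) := by
        refine Finset.sum_le_sum fun p _ => ?_
        have := sf_bad a (hA a ha) ((p:ℕ)^2) (pow_pos p.2.pos 2) R
        push_cast at this ⊢
        simpa [B] using this
      rw [← Finset.mul_sum] at h6
      have h7 := hs₀ u (Finset.disjoint_of_subset_right hss Finset.sdiff_disjoint)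
      have h8 := (le_abs_self _).trans h7.le
      have h9 := mul_le_mul_of_nonneg_left h8 (show (0:ℝ) ≤ 2 * ((R:ℝ) + 1) by positivity)
      linarith
    have h1' := (Nat.cast_le (α := ℝ)).2 h1
    push_cast at h1' h2 ⊢
    linarith
  have key2 : ∀ R : ℕ,
      (((Finset.Icc (-(R:ℤ)) R).filter (fun t : ℤ => ∀ a ∈ A, Squarefree (t + a))).card : ℝ) ≤
      (((Finset.Icc (-(R:ℤ)) R).filter
        (fun t : ℤ => ∀ p ∈ s, ∀ a ∈ A, ¬ (((p:ℕ)^2 : ℕ) : ℤ) ∣ t + a)).card : ℝ) := by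
    intro R
    rw [Nat.cast_le]
    refine Finset.card_le_card fun t ht => ?_
    obtain ⟨htI, h⟩ := Finset.mem_filter.1 ht
    exact Finset.mem_filter.2 ⟨htI, fun p _ a ha => (sf_squarefree_iff _).1 (h a ha) p⟩
  obtain ⟨N, hN⟩ := exists_nat_gt ((C + k) / (ε / 4))
  refine ⟨N + 1, fun R hR => ?_⟩
  have hR1 : (1:ℝ) ≤ R := by exact_mod_cast (by omega : 1 ≤ R)
  have hRN : (N:ℝ) ≤ R := by exact_mod_cast (by omega : N ≤ R)
  have k1 := key R
  have k2 := key2 R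
  have k3 := abs_le.1 (hC R)
  have k4 := abs_lt.1 hsP
  generalize (((Finset.Icc (-(R:ℤ)) R).filter (fun t : ℤ => ∀ a ∈ A, Squarefree (t + a))).card : ℝ) = X at *
  generalize (((Finset.Icc (-(R:ℤ)) R).filter
        (fun t : ℤ => ∀ p ∈ s, ∀ a ∈ A, ¬ (((p:ℕ)^2 : ℕ) : ℤ) ∣ t + a)).card : ℝ) = Y at *
  generalize ∏ p ∈ s, (1 - k / ((p:ℕ):ℝ)^2) = D at *
  have hCk : C + k < R * (ε / 4) := by
    rw [div_lt_iff₀ (by positivity)] at hN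
    nlinarith
  have hke : k * (ε / (8 * (k + 1))) ≤ ε / 8 := by
    rw [← mul_div_assoc, div_le_div_iff₀ (by positivity) (by positivity)]
    nlinarith
  have hke2 : k * (1 + 2 * ((R:ℝ) + 1) * (ε / (8 * (k + 1)))) ≤ k + R * (ε / 2) := by
    have : 2 * ((R:ℝ) + 1) * (k * (ε / (8 * (k + 1)))) ≤ 2 * ((R:ℝ) + 1) * (ε / 8) :=
      mul_le_mul_of_nonneg_left hke (by positivity)
    nlinarith
  have hD1 : (R:ℝ) * (D - P) < R * (ε / 4) := mul_lt_mul_of_pos_left k4.2 (by linarith)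
  have hD2 : (R:ℝ) * (-(ε / 4)) < R * (D - P) := mul_lt_mul_of_pos_left k4.1 (by linarith)
  have hRe : 0 < (R:ℝ) * ε := by positivity
  rw [Real.dist_eq, abs_lt]
  have hX : X / (2 * R) - P = (X - 2 * R * P) / (2 * R) := by field_simp
  rw [hX, lt_div_iff₀ (by positivity), div_lt_iff₀ (by positivity)]
  constructor <;> nlinarith

theorem squarefree_patch_densities :
    Tendsto (fun R : ℕ =>
      (Nat.card {t : ℤ // t ∈ Finset.Icc (-(R : ℤ)) (R : ℤ) ∧
          Squarefree (t - 1) ∧ Squarefree t ∧ Squarefree (t + 1)} : ℝ) / (2 * R))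
      atTop (nhds (∏' p : Nat.Primes, (1 - 3 / ((p : ℕ) : ℝ)^2))) ∧
    Tendsto (fun R : ℕ =>
      (Nat.card {t : ℤ // t ∈ Finset.Icc (-(R : ℤ)) (R : ℤ) ∧
          Squarefree (t - 1) ∧ Squarefree t ∧ ¬ Squarefree (t + 1)} : ℝ) / (2 * R))
      atTop (nhds ((∏' p : Nat.Primes, (1 - 2 / ((p : ℕ) : ℝ)^2)) -
        ∏' p : Nat.Primes, (1 - 3 / ((p : ℕ) : ℝ)^2))) := by
  classical
  have hcard : ∀ (R : ℕ) (Q : ℤ → Prop) [DecidablePred Q],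
      Nat.card {t : ℤ // t ∈ Finset.Icc (-(R : ℤ)) (R : ℤ) ∧ Q t}
        = ((Finset.Icc (-(R:ℤ)) R).filter Q).card := by
    intro R Q _
    rw [Nat.subtype_card]
    intro t
    exact Finset.mem_filter
  have h3 := sf_density {-1, 0, 1} (by decide)
  have h2 := sf_density {-1, 0} (by decide)
  rw [show (({-1, 0, 1} : Finset ℤ).card : ℝ) = 3 by
    rw [show ({-1, 0, 1} : Finset ℤ).card = 3 by decide]; norm_num] at h3
  rw [show (({-1, 0} : Finset ℤ).card : ℝ) = 2 by
    rw [show ({-1, 0} : Finset ℤ).card = 2 by decide]; norm_num] at h2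
  simp only [Finset.mem_insert, Finset.mem_singleton, forall_eq_or_imp, forall_eq, add_zero,
    ← sub_eq_add_neg] at h2 h3
  refine ⟨?_, ?_⟩
  · simp only [hcard]
    convert h3
  · simp only [hcard]
    refine (h2.sub h3).congr fun R => ?_
    rw [← sub_div]
    congr 1
    rw [sub_eq_iff_eq_add, ← Nat.cast_add, Nat.cast_inj]
    rw [← Finset.card_union_of_disjoint]
    · congr 1
      ext t
      simp only [Finset.mem_filter, Finset.mem_union]
      tauto
    · rw [Finset.disjoint_left]
      intro t ht ht'
      exact (Finset.mem_filter.1 ht).2.2.2 (Finset.mem_filter.1 ht').2.2.2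
end
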